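/- (Theorem 3(ii), double robustness with respect to the outcome-regression model.) Under the DiD identification setup, let p := E[1_M ∣ ℋ] / (E[1_M ∣ ℋ] + E[1_S ∣ ℋ]) be the true generalized propensity score, assume there is ε > 0 with ε ≤ p ≤ 1 − ε a.s., and set r := p / (1 − p). Then for EVERY ℋ-measurable bounded function m̃ : Ω → ℝ (an arbitrary, possibly misspecified, outcome-regression function), one has E[(1_M / P(M) − r · 1_S / E[r · 1_S]) · (ΔY − m̃)] = E[Yobs_t − Y⁰_t ∣ M]. -/

import Mathlib

open MeasureTheory

/-- The generalized propensity score `p = E[1_M ∣ ℋ] / (E[1_M ∣ ℋ] + E[1_S ∣ ℋ])`. -/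
noncomputable def gps {Ω : Type*} {𝔉 : MeasurableSpace Ω} (P : Measure Ω)
    (ℋ : MeasurableSpace Ω) (M S : Set Ω) : Ω → ℝ := fun ω =>
  (P[M.indicator (fun _ => (1 : ℝ)) | ℋ]) ω /
    ((P[M.indicator (fun _ => (1 : ℝ)) | ℋ]) ω + (P[S.indicator (fun _ => (1 : ℝ)) | ℋ]) ω)

/-- The odds ratio `r = p / (1 − p)` of the generalized propensity score. -/
noncomputable def gpsOdds {Ω : Type*} {𝔉 : MeasurableSpace Ω} (P : Measure Ω)
    (ℋ : MeasurableSpace Ω) (M S : Set Ω) : Ω → ℝ := fun ω =>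
  gps P ℋ M S ω / (1 - gps P ℋ M S ω)

/-- Pull-out and tower property: an `m`-measurable weight does not see the difference between
`f` and its conditional expectation given `m`. -/
lemma integral_mul_condExp_eq {Ω : Type*} {m m₀ : MeasurableSpace Ω} {μ : Measure Ω}
    [IsProbabilityMeasure μ] (hm : m ≤ m₀) {w f : Ω → ℝ} (hw : StronglyMeasurable[m] w)
    (hwf : Integrable (fun ω => w ω * f ω) μ) (hf : Integrable f μ) :
    ∫ ω, w ω * (μ[f | m]) ω ∂μ = ∫ ω, w ω * f ω ∂μ := by
  rw [← integral_condExp hm (f := fun ω => w ω * f ω)]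
  exact integral_congr_ae (condExp_mul_of_stronglyMeasurable_left hw hwf hf).symm

/-- One-step conditional parallel trends add up to conditional parallel long differences. -/
lemma condExp_sub_eq_of_parallel_trends {Ω : Type*} {𝔉 : MeasurableSpace Ω} {P : Measure Ω}
    {m₁ m₂ : MeasurableSpace Ω} {s t : ℕ} {Y : ℕ → Ω → ℝ}
    (hY : ∀ r, s ≤ r → r ≤ t → Integrable (Y r) P)
    (hpt : ∀ r, s < r → r ≤ t →
      P[fun ω => Y r ω - Y (r - 1) ω | m₁] =ᵐ[P] P[fun ω => Y r ω - Y (r - 1) ω | m₂])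
    (r : ℕ) (hsr : s ≤ r) (hrt : r ≤ t) :
    P[fun ω => Y r ω - Y s ω | m₁] =ᵐ[P] P[fun ω => Y r ω - Y s ω | m₂] := by
  induction r, hsr using Nat.le_induction with
  | base => simp only [sub_self]; simp [← Pi.zero_def, condExp_zero]
  | succ k hk ih =>
    have hYk := hY k hk (by omega)
    have hsplit : (fun ω => Y (k + 1) ω - Y s ω)
        = (fun ω => Y (k + 1) ω - Y k ω) + fun ω => Y k ω - Y s ω := by
      ext ω; simp
    have h₁ : Integrable (fun ω => Y (k + 1) ω - Y k ω) P := (hY _ (by omega) hrt).sub hYk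
    have h₂ : Integrable (fun ω => Y k ω - Y s ω) P := hYk.sub (hY s le_rfl (by omega))
    rw [hsplit]
    refine (condExp_add h₁ h₂ m₁).trans (Filter.EventuallyEq.trans ?_ (condExp_add h₁ h₂ m₂).symm)
    exact (hpt (k + 1) (by omega) hrt).add (ih (by omega))

lemma stronglyMeasurable_gpsOdds {Ω : Type*} {𝔉 : MeasurableSpace Ω} (P : Measure Ω)
    (ℋ : MeasurableSpace Ω) (M S : Set Ω) : StronglyMeasurable[ℋ] (gpsOdds P ℋ M S) := by
  have hm : Measurable[ℋ] (P[M.indicator (fun _ => (1 : ℝ)) | ℋ]) :=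
    stronglyMeasurable_condExp.measurable
  have hq : Measurable[ℋ] (P[S.indicator (fun _ => (1 : ℝ)) | ℋ]) :=
    stronglyMeasurable_condExp.measurable
  have hg : Measurable[ℋ] (gps P ℋ M S) := hm.div (hm.add hq)
  have hr : Measurable[ℋ] (gpsOdds P ℋ M S) := hg.div (measurable_const.sub hg)
  exact hr.stronglyMeasurable

/-- The odds ratio of the generalized propensity score is `E[1_M ∣ ℋ] / E[1_S ∣ ℋ]`. -/
lemma gpsOdds_mul_condExp {Ω : Type*} {𝔉 : MeasurableSpace Ω} {P : Measure Ω}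
    {ℋ : MeasurableSpace Ω} {M S : Set Ω} {ω : Ω}
    (hsum : (P[M.indicator (fun _ => (1 : ℝ)) | ℋ]) ω
      + (P[S.indicator (fun _ => (1 : ℝ)) | ℋ]) ω ≠ 0)
    (hS : (P[S.indicator (fun _ => (1 : ℝ)) | ℋ]) ω ≠ 0) :
    gpsOdds P ℋ M S ω * (P[S.indicator (fun _ => (1 : ℝ)) | ℋ]) ω
      = (P[M.indicator (fun _ => (1 : ℝ)) | ℋ]) ω := by
  have h : 1 - gps P ℋ M S ω = (P[S.indicator (fun _ => (1 : ℝ)) | ℋ]) ω /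
      ((P[M.indicator (fun _ => (1 : ℝ)) | ℋ]) ω
        + (P[S.indicator (fun _ => (1 : ℝ)) | ℋ]) ω) := by
    unfold gps
    field_simp
    ring
  unfold gpsOdds
  rw [h]
  unfold gps
  field_simp

/-- Theorem 3(ii) (double robustness w.r.t. the outcome-regression model): with the true
generalized propensity score `p` (bounded away from 0 and 1) and `r = p/(1−p)`, for EVERY
ℋ-measurable bounded, possibly misspecified, outcome-regression function `m̃`, the DR
estimand equals the ATEM. -/
theorem atem_doubly_robust_in_outcome_regression
    {Ω : Type*} {𝔉 : MeasurableSpace Ω} (P : Measure Ω) [IsProbabilityMeasure P]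
    (s t : ℕ) (hst : s < t)
    (Y0 : ℕ → Ω → ℝ) (hY0int : ∀ r, s ≤ r → r ≤ t → Integrable (Y0 r) P)
    (Yobs_t Yobs_s : Ω → ℝ) (hYt : Integrable Yobs_t P) (hYs : Integrable Yobs_s P)
    (ℋ 𝒟σ : MeasurableSpace Ω) (hℋ : ℋ ≤ 𝔉) (h𝒟 : 𝒟σ ≤ 𝔉)
    (M S : Set Ω) (hM : MeasurableSet[𝒟σ] M) (hS : MeasurableSet[𝒟σ] S)
    (hMS : Disjoint M S) (hPM : 0 < P M)
    (hcons_s : ∀ᵐ ω ∂P, ω ∈ M ∪ S → Yobs_s ω = Y0 s ω)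
    (hcons_t : ∀ᵐ ω ∂P, ω ∈ S → Yobs_t ω = Y0 t ω)
    (hpt : ∀ r, s < r → r ≤ t →
      P[fun ω => Y0 r ω - Y0 (r - 1) ω | 𝒟σ ⊔ ℋ]
        =ᵐ[P] P[fun ω => Y0 r ω - Y0 (r - 1) ω | ℋ])
    (ε : ℝ) (hε : 0 < ε)
    (hoverS : ∀ᵐ ω ∂P, ε ≤ (P[S.indicator (fun _ => (1 : ℝ)) | ℋ]) ω
        ∧ (P[S.indicator (fun _ => (1 : ℝ)) | ℋ]) ω ≤ 1 - ε)
    (hoverp : ∀ᵐ ω ∂P, ε ≤ gps P ℋ M S ω ∧ gps P ℋ M S ω ≤ 1 - ε)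
    :
    ∀ mtilde : Ω → ℝ, Measurable[ℋ] mtilde → (∃ C : ℝ, ∀ ω, |mtilde ω| ≤ C) →
      (∫ ω, (M.indicator (fun _ => (1 : ℝ)) ω / (P M).toReal
          - gpsOdds P ℋ M S ω * S.indicator (fun _ => (1 : ℝ)) ω
              / (∫ ω', gpsOdds P ℋ M S ω' * S.indicator (fun _ => (1 : ℝ)) ω' ∂P))
          * ((Yobs_t ω - Yobs_s ω) - mtilde ω) ∂P)
        = (∫ ω in M, (Yobs_t ω - Y0 t ω) ∂P) / (P M).toReal := by
  rintro mt hmt ⟨C, hC⟩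
  set r := gpsOdds P ℋ M S with hr
  set iM : Ω → ℝ := M.indicator (fun _ => (1 : ℝ)) with hiM
  set iS : Ω → ℝ := S.indicator (fun _ => (1 : ℝ)) with hiS
  have hM' : MeasurableSet[𝔉] M := h𝒟 _ hM
  have hS' : MeasurableSet[𝔉] S := h𝒟 _ hS
  have hsup : 𝒟σ ⊔ ℋ ≤ 𝔉 := sup_le h𝒟 hℋ
  have hrH : StronglyMeasurable[ℋ] r := stronglyMeasurable_gpsOdds P ℋ M S
  have hiM_int : Integrable iM P := (integrable_const 1).indicator hM'
  have hiS_int : Integrable iS P := (integrable_const 1).indicator hS'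
  have hiM_le : ∀ ω, ‖iM ω‖ ≤ 1 := fun ω => by
    by_cases h : ω ∈ M <;> simp [hiM, h]
  have hiS_le : ∀ ω, ‖iS ω‖ ≤ 1 := fun ω => by
    by_cases h : ω ∈ S <;> simp [hiS, h]
  have hr_le : ∀ᵐ ω ∂P, ‖r ω‖ ≤ 1 / ε := by
    filter_upwards [hoverp] with ω ⟨h₁, h₂⟩
    have hpos : 0 < 1 - gps P ℋ M S ω := by linarith
    rw [hr, gpsOdds, Real.norm_of_nonneg (div_nonneg (by linarith) hpos.le)]
    exact div_le_div₀ zero_le_one (by linarith) hε (by linarith)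
  have hrq : ∀ᵐ ω ∂P, r ω * (P[iS | ℋ]) ω = (P[iM | ℋ]) ω := by
    have hm : 0 ≤ᵐ[P] P[iM | ℋ] :=
      condExp_nonneg (ae_of_all _ fun ω => Set.indicator_nonneg (fun _ _ => zero_le_one) ω)
    filter_upwards [hoverS, hm] with ω h₁ h₂
    have h₂' : 0 ≤ (P[iM | ℋ]) ω := h₂
    exact gpsOdds_mul_condExp (by linarith [h₁.1] : _ < _).ne' (by linarith [h₁.1] : _ < _).ne'
  have hwM : ∀ {f : Ω → ℝ}, Integrable f P → Integrable (fun ω => iM ω * f ω) P := fun hf =>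
    hf.bdd_mul hiM_int.aestronglyMeasurable (ae_of_all _ hiM_le)
  have hrS_meas : StronglyMeasurable[𝒟σ ⊔ ℋ] (fun ω => r ω * iS ω) :=
    (hrH.mono le_sup_right).mul
      ((stronglyMeasurable_const.indicator hS).mono le_sup_left)
  have hwS : ∀ {f : Ω → ℝ}, Integrable f P → Integrable (fun ω => r ω * iS ω * f ω) P := by
    intro f hf
    refine hf.bdd_mul (c := 1 / ε) (hrS_meas.mono hsup).aestronglyMeasurable ?_
    filter_upwards [hr_le] with ω h
    rw [norm_mul]
    nlinarith [hiS_le ω, norm_nonneg (iS ω), norm_nonneg (r ω)]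
  have hbal : ∀ {Z : Ω → ℝ}, StronglyMeasurable[ℋ] Z → Integrable Z P →
      ∫ ω, r ω * iS ω * Z ω ∂P = ∫ ω, iM ω * Z ω ∂P := by
    intro Z hZ hZi
    have e₁ := integral_mul_condExp_eq (f := iS) hℋ (hrH.mul hZ)
      ((hwS hZi).congr (ae_of_all _ fun ω => by simp; ring)) hiS_int
    have e₂ := integral_mul_condExp_eq (f := iM) hℋ hZ
      ((hwM hZi).congr (ae_of_all _ fun ω => mul_comm _ _)) hiM_int
    calc ∫ ω, r ω * iS ω * Z ω ∂P
        = ∫ ω, (r * Z) ω * iS ω ∂P := by congr 1; ext ω; simp; ring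
      _ = ∫ ω, (r * Z) ω * (P[iS | ℋ]) ω ∂P := e₁.symm
      _ = ∫ ω, Z ω * (P[iM | ℋ]) ω ∂P := by
          refine integral_congr_ae ?_
          filter_upwards [hrq] with ω h
          rw [← h, Pi.mul_apply]; ring
      _ = ∫ ω, iM ω * Z ω ∂P := by rw [e₂]; congr 1; ext ω; ring
  have hD : Integrable (fun ω => Y0 t ω - Y0 s ω) P :=
    (hY0int t hst.le le_rfl).sub (hY0int s le_rfl hst.le)
  have htrend := condExp_sub_eq_of_parallel_trends hY0int hpt t hst.le le_rfl
  have hD_eq : ∀ {w : Ω → ℝ}, StronglyMeasurable[𝒟σ ⊔ ℋ] w →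
      Integrable (fun ω => w ω * (Y0 t ω - Y0 s ω)) P →
      ∫ ω, w ω * (Y0 t ω - Y0 s ω) ∂P
        = ∫ ω, w ω * (P[fun ω => Y0 t ω - Y0 s ω | ℋ]) ω ∂P := by
    intro w hw hwD
    rw [← integral_mul_condExp_eq hsup hw hwD hD]
    refine integral_congr_ae ?_
    filter_upwards [htrend] with ω h
    rw [h]
  have hD_bal : ∫ ω, r ω * iS ω * (Y0 t ω - Y0 s ω) ∂P = ∫ ω, iM ω * (Y0 t ω - Y0 s ω) ∂P := by
    rw [hD_eq hrS_meas (hwS hD), hbal stronglyMeasurable_condExp integrable_condExp,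
      hD_eq ((stronglyMeasurable_const.indicator hM).mono le_sup_left) (hwM hD)]
  have hden : ∫ ω, r ω * iS ω ∂P = (P M).toReal := by
    have h := hbal (Z := fun _ => 1) stronglyMeasurable_const (integrable_const 1)
    simp only [mul_one] at h
    rw [h, hiM, integral_indicator_const _ hM']
    simp [Measure.real]
  have hmt_int : Integrable mt P :=
    (integrable_const C).mono' (hmt.mono hℋ le_rfl).aestronglyMeasurable (ae_of_all _ hC)
  have hS_obs : ∫ ω, r ω * iS ω * (Yobs_t ω - Yobs_s ω) ∂P
      = ∫ ω, iM ω * (Y0 t ω - Y0 s ω) ∂P := by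
    rw [← hD_bal]
    refine integral_congr_ae ?_
    filter_upwards [hcons_s, hcons_t] with ω h₁ h₂
    by_cases h : ω ∈ S
    · rw [h₁ (Or.inr h), h₂ h]
    · simp [hiS, h]
  have hΔ : Integrable (fun ω => Yobs_t ω - Yobs_s ω) P := hYt.sub hYs
  have hM_obs : ∫ ω, iM ω * (Yobs_t ω - Yobs_s ω) ∂P - ∫ ω, iM ω * (Y0 t ω - Y0 s ω) ∂P
      = ∫ ω in M, (Yobs_t ω - Y0 t ω) ∂P := by
    rw [← integral_sub (hwM hΔ) (hwM hD), ← integral_indicator hM']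
    refine integral_congr_ae ?_
    filter_upwards [hcons_s] with ω h₁
    by_cases h : ω ∈ M
    · simp [hiM, h, h₁ (Or.inl h)]
    · simp [hiM, h]
  rw [hden]
  calc ∫ ω, (iM ω / (P M).toReal - r ω * iS ω / (P M).toReal)
        * ((Yobs_t ω - Yobs_s ω) - mt ω) ∂P
      = ∫ ω, ((iM ω * (Yobs_t ω - Yobs_s ω) - iM ω * mt ω)
          - (r ω * iS ω * (Yobs_t ω - Yobs_s ω) - r ω * iS ω * mt ω)) / (P M).toReal ∂P := by
        congr 1; ext ω; ring
    _ = ((∫ ω, iM ω * (Yobs_t ω - Yobs_s ω) ∂P - ∫ ω, iM ω * mt ω ∂P)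
          - (∫ ω, r ω * iS ω * (Yobs_t ω - Yobs_s ω) ∂P - ∫ ω, r ω * iS ω * mt ω ∂P))
          / (P M).toReal := by
        have hMi : Integrable (fun ω => iM ω * (Yobs_t ω - Yobs_s ω) - iM ω * mt ω) P :=
          (hwM hΔ).sub (hwM hmt_int)
        have hSi : Integrable
            (fun ω => r ω * iS ω * (Yobs_t ω - Yobs_s ω) - r ω * iS ω * mt ω) P :=
          (hwS hΔ).sub (hwS hmt_int)
        rw [integral_div, integral_sub hMi hSi, integral_sub (hwM hΔ) (hwM hmt_int),
          integral_sub (hwS hΔ) (hwS hmt_int)]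
    _ = (∫ ω in M, (Yobs_t ω - Y0 t ω) ∂P) / (P M).toReal := by
        rw [hbal hmt.stronglyMeasurable hmt_int, hS_obs, ← hM_obs]
        ring
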